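/- arXiv:2202.10375 — 3 statements merged into one kernel-verified Lean document; each statement's English description precedes it below -/
import Mathlib

section
/- Let P ⊆ Λ₂ be a set of plaquettes. The number of homomorphisms ψ ∈ Ω = Hom(π₁(S₁(Λ), x₀), G) with supp(ψ) = P is at most |G|^{|P|}. -/
open Classical SimpleGraph
open scoped BigOperators

noncomputable section

namespace LGT

/-- A site of `ℤ⁴`. -/
abbrev Site : Type := Fin 4 → ℤ

/-- The `i`-th coordinate unit vector. -/
def unit (i : Fin 4) : Site := fun j => if j = i then 1 else 0

lemma unit_apply_self (i : Fin 4) : unit i i = 1 := by simp [unit]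

lemma unit_apply_nonneg (i j : Fin 4) : 0 ≤ unit i j := by
  by_cases h : j = i <;> simp [unit, h]

lemma unit_ne_zero (i : Fin 4) : unit i ≠ 0 := by
  intro h
  have h1 := congrFun h i
  rw [unit_apply_self] at h1
  exact one_ne_zero h1

/-- The lattice `Λ = ([a₁,b₁] × ⋯ × [a₄,b₄]) ∩ ℤ⁴`, with all side lengths equal. -/
structure Box where
  a : Fin 4 → ℤ
  b : Fin 4 → ℤ
  side_eq : ∀ i j : Fin 4, b i - a i = b j - a j

/-- Membership of a site in the lattice `Λ`. -/
def Box.mem (Λ : Box) (x : Site) : Prop := ∀ i, Λ.a i ≤ x i ∧ x i ≤ Λ.b i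

/-- The set of vertices `Λ₀` of the lattice. -/
abbrev VSite (Λ : Box) : Type := {x : Site // Λ.mem x}

lemma not_both {x y : Site} {i j : Fin 4} (h1 : y = x + unit i) (h2 : x = y + unit j) :
    False := by
  subst h1
  rw [add_assoc] at h2
  have h3 : unit i + unit j = 0 := left_eq_add.mp h2
  have h4 := congrFun h3 i
  rw [Pi.add_apply, Pi.zero_apply, unit_apply_self] at h4
  have h5 : (0:ℤ) ≤ unit j i := unit_apply_nonneg j i
  omega

/-- The 1-skeleton `S₁(Λ)` of the lattice, as a graph on the vertices of `Λ`:
two vertices are adjacent iff they differ by a coordinate unit vector. -/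
def latticeGraph (Λ : Box) : SimpleGraph (VSite Λ) where
  Adj u v := ∃ i : Fin 4, (v : Site) = (u : Site) + unit i ∨ (u : Site) = (v : Site) + unit i
  symm := by
    constructor
    rintro u v ⟨i, h | h⟩
    · exact ⟨i, Or.inr h⟩
    · exact ⟨i, Or.inl h⟩
  loopless := by
    constructor
    rintro u ⟨i, h | h⟩ <;> exact unit_ne_zero i (left_eq_add.mp h)

/-- The set `Λ₁` of positively oriented nearest-neighbour edges of `Λ`:
an edge is a pair (base site, direction) whose endpoints both lie in `Λ`. -/
abbrev PEdge (Λ : Box) : Type :=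
  {e : Site × Fin 4 // Λ.mem e.1 ∧ Λ.mem (e.1 + unit e.2)}

/-- The initial vertex of a positively oriented edge. -/
def PEdge.v0 {Λ : Box} (e : PEdge Λ) : VSite Λ := ⟨e.1.1, e.2.1⟩

/-- The final vertex of a positively oriented edge. -/
def PEdge.v1 {Λ : Box} (e : PEdge Λ) : VSite Λ := ⟨e.1.1 + unit e.1.2, e.2.2⟩

/-- Edge configurations `σ ∈ G^{Λ₁}`. -/
abbrev EdgeConf (Λ : Box) (G : Type*) : Type _ := PEdge Λ → G

variable {G : Type*} [Group G]

/-- The value of an edge configuration on an oriented edge `(u, v)`: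
`σ_e` on positively oriented edges, `σ_e⁻¹` on negatively oriented ones. -/
def oval {Λ : Box} (σ : EdgeConf Λ G) (u v : VSite Λ) : G :=
  if h : ∃ i : Fin 4, (v : Site) = (u : Site) + unit i then
    σ ⟨((u : Site), h.choose), u.2, by rw [← h.choose_spec]; exact v.2⟩
  else if h' : ∃ i : Fin 4, (u : Site) = (v : Site) + unit i then
    (σ ⟨((v : Site), h'.choose), v.2, by rw [← h'.choose_spec]; exact u.2⟩)⁻¹
  else 1

/-- The holonomy `σ_γ = σ_{e₁} ⋯ σ_{eₙ}` of an edge configuration along a walk. -/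
def hol {Λ : Box} (σ : EdgeConf Λ G) {u v : VSite Λ}
    (w : (latticeGraph Λ).Walk u v) : G :=
  (w.darts.map fun d => oval σ d.toProd.1 d.toProd.2).prod

@[simp] lemma hol_nil {Λ : Box} (σ : EdgeConf Λ G) {u : VSite Λ} :
    hol σ (SimpleGraph.Walk.nil : (latticeGraph Λ).Walk u u) = 1 := by simp [hol]

lemma hol_cons {Λ : Box} (σ : EdgeConf Λ G) {u m v : VSite Λ}
    (h : (latticeGraph Λ).Adj u m) (q : (latticeGraph Λ).Walk m v) :
    hol σ (SimpleGraph.Walk.cons h q) = oval σ u m * hol σ q := by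
  simp [hol]

lemma hol_append {Λ : Box} (σ : EdgeConf Λ G) {u v w : VSite Λ}
    (p : (latticeGraph Λ).Walk u v) (q : (latticeGraph Λ).Walk v w) :
    hol σ (p.append q) = hol σ p * hol σ q := by
  simp [hol, SimpleGraph.Walk.darts_append]

lemma oval_mul_oval {Λ : Box} (σ : EdgeConf Λ G) {u v : VSite Λ}
    (h : (latticeGraph Λ).Adj u v) : oval σ u v * oval σ v u = 1 := by
  obtain ⟨i, hi | hi⟩ := h
  · have h1 : ∃ k : Fin 4, (v : Site) = (u : Site) + unit k := ⟨i, hi⟩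
    have h2 : ¬ ∃ k : Fin 4, (u : Site) = (v : Site) + unit k := by
      rintro ⟨k, hk⟩; exact not_both hi hk
    simp only [oval]
    rw [dif_pos h1, dif_neg h2, dif_pos h1]
    exact mul_inv_cancel _
  · have h1 : ∃ k : Fin 4, (u : Site) = (v : Site) + unit k := ⟨i, hi⟩
    have h2 : ¬ ∃ k : Fin 4, (v : Site) = (u : Site) + unit k := by
      rintro ⟨k, hk⟩; exact not_both hk hi
    simp only [oval]
    rw [dif_neg h2, dif_pos h1, dif_pos h1]
    exact inv_mul_cancel _

/-- One step of combinatorial homotopy of walks in the 1-skeleton: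
inserting or removing a backtracking `e e⁻¹`. -/
inductive HStep {Λ : Box} :
    {u v : VSite Λ} → (latticeGraph Λ).Walk u v → (latticeGraph Λ).Walk u v → Prop
  | mk {u x y v : VSite Λ} (p : (latticeGraph Λ).Walk u x) (h : (latticeGraph Λ).Adj x y)
      (q : (latticeGraph Λ).Walk x v) :
      HStep (p.append (SimpleGraph.Walk.cons h (SimpleGraph.Walk.cons h.symm q)))
        (p.append q)

/-- Two walks in the 1-skeleton are homotopic if they differ by finitely many
insertions/removals of backtrackings.  The equivalence classes of closed walks based
at `x₀` are exactly the elements of the fundamental group `π₁(S₁(Λ), x₀)`. -/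
def Homotopic {Λ : Box} {u v : VSite Λ}
    (w₁ w₂ : (latticeGraph Λ).Walk u v) : Prop :=
  Relation.EqvGen (@HStep Λ u v) w₁ w₂

lemma hol_of_hstep {Λ : Box} (σ : EdgeConf Λ G) {u v : VSite Λ}
    {w₁ w₂ : (latticeGraph Λ).Walk u v} (h : HStep w₁ w₂) : hol σ w₁ = hol σ w₂ := by
  cases h with
  | mk p had q =>
    simp only [hol_append, hol_cons, ← mul_assoc]
    rw [mul_assoc (hol σ p), oval_mul_oval σ had, mul_one]

lemma hol_homotopic {Λ : Box} (σ : EdgeConf Λ G) {u v : VSite Λ}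
    {w₁ w₂ : (latticeGraph Λ).Walk u v} (h : Homotopic w₁ w₂) : hol σ w₁ = hol σ w₂ := by
  induction h with
  | rel _ _ hs => exact hol_of_hstep σ hs
  | refl _ => rfl
  | symm _ _ _ ih => exact ih.symm
  | trans _ _ _ _ _ ih₁ ih₂ => exact ih₁.trans ih₂

/-- The set `Ω = Hom(π₁(S₁(Λ), x₀), G)` of homomorphisms from the fundamental group
of the 1-skeleton based at `x₀` to `G`, modelled as functions on closed walks at `x₀`
that are homotopy invariant and multiplicative under concatenation. -/
structure Hom (Λ : Box) (x₀ : VSite Λ) (G : Type*) [Group G] where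
  toFun : (latticeGraph Λ).Walk x₀ x₀ → G
  invariant : ∀ w₁ w₂ : (latticeGraph Λ).Walk x₀ x₀, Homotopic w₁ w₂ → toFun w₁ = toFun w₂
  map_mul : ∀ w₁ w₂ : (latticeGraph Λ).Walk x₀ x₀, toFun (w₁.append w₂) = toFun w₁ * toFun w₂

/-- The map `ψ_{x₀} : G^{Λ₁} → Ω` sending an edge configuration to the induced
homomorphism of the fundamental group, given by holonomy along loops. -/
def psi (Λ : Box) (x₀ : VSite Λ) (σ : EdgeConf Λ G) : Hom Λ x₀ G where
  toFun := hol σ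
  invariant := fun _ _ h => hol_homotopic σ h
  map_mul := fun w₁ w₂ => hol_append σ w₁ w₂


/-- The set `Λ₂` of plaquettes of `Λ`: unit squares, given by a base site and two
distinct directions, all four of whose corners (hence all four boundary edges) lie in `Λ`. -/
abbrev Plaq (Λ : Box) : Type :=
  {q : Site × Fin 4 × Fin 4 //
    q.2.1 < q.2.2 ∧ Λ.mem q.1 ∧ Λ.mem (q.1 + unit q.2.1) ∧
    Λ.mem (q.1 + unit q.2.1 + unit q.2.2) ∧ Λ.mem (q.1 + unit q.2.2)}

namespace Plaq

variable {Λ : Box}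

/-- First corner `x₁` of a plaquette. -/
def c0 (p : Plaq Λ) : VSite Λ := ⟨p.1.1, p.2.2.1⟩
/-- Second corner `x₂` of a plaquette. -/
def c1 (p : Plaq Λ) : VSite Λ := ⟨p.1.1 + unit p.1.2.1, p.2.2.2.1⟩
/-- Third corner `x₃` of a plaquette. -/
def c2 (p : Plaq Λ) : VSite Λ := ⟨p.1.1 + unit p.1.2.1 + unit p.1.2.2, p.2.2.2.2.1⟩
/-- Fourth corner `x₄` of a plaquette. -/
def c3 (p : Plaq Λ) : VSite Λ := ⟨p.1.1 + unit p.1.2.2, p.2.2.2.2.2⟩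

/-- A site is a corner (vertex) of the plaquette. -/
def isCorner (p : Plaq Λ) (x : Site) : Prop :=
  x = (p.c0 : Site) ∨ x = (p.c1 : Site) ∨ x = (p.c2 : Site) ∨ x = (p.c3 : Site)

lemma adj01 (p : Plaq Λ) : (latticeGraph Λ).Adj p.c0 p.c1 := ⟨p.1.2.1, Or.inl rfl⟩
lemma adj12 (p : Plaq Λ) : (latticeGraph Λ).Adj p.c1 p.c2 := ⟨p.1.2.2, Or.inl rfl⟩
lemma adj23 (p : Plaq Λ) : (latticeGraph Λ).Adj p.c2 p.c3 :=
  ⟨p.1.2.1, Or.inr (add_right_comm p.1.1 (unit p.1.2.1) (unit p.1.2.2))⟩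
lemma adj30 (p : Plaq Λ) : (latticeGraph Λ).Adj p.c3 p.c0 := ⟨p.1.2.2, Or.inr rfl⟩

end Plaq

/-- The counter-clockwise boundary loop `γ_p : x₁ → x₂ → x₃ → x₄ → x₁` of a plaquette. -/
def plaqWalk {Λ : Box} (p : Plaq Λ) : (latticeGraph Λ).Walk p.c0 p.c0 :=
  SimpleGraph.Walk.cons p.adj01 (SimpleGraph.Walk.cons p.adj12
    (SimpleGraph.Walk.cons p.adj23 (SimpleGraph.Walk.cons p.adj30 SimpleGraph.Walk.nil)))

variable {G : Type*} [Group G]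

/-- The plaquette variable `σ_p`: the holonomy of `σ` around the boundary of `p`. -/
def holP {Λ : Box} (σ : EdgeConf Λ G) (p : Plaq Λ) : G := hol σ (plaqWalk p)

/-- The support of an edge configuration: the plaquettes `p` with `σ_p ≠ 1`. -/
def esupp {Λ : Box} (σ : EdgeConf Λ G) : Set (Plaq Λ) := {p | holP σ p ≠ 1}

/-- The character `χ = Tr ρ` of a unitary representation `ρ` of `G` of dimension `d`. -/
def chi {G : Type*} [Group G] {d : ℕ} (ρ : G →* Matrix.unitaryGroup (Fin d) ℂ) (g : G) : ℂ :=
  Matrix.trace ((ρ g : Matrix (Fin d) (Fin d) ℂ))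

/-- `Δ_G := min_{g ≠ 1} Re (χ(1) - χ(g))`. -/
def DeltaG (G : Type*) [Group G] (χ : G → ℂ) : ℝ :=
  sInf ((fun g => (χ 1 - χ g).re) '' {g : G | g ≠ 1})

/-- `φ_β(g) = exp(-β Re(χ(1) - χ(g)))`. -/
def phiB {G : Type*} [Group G] (χ : G → ℂ) (β : ℝ) (g : G) : ℝ :=
  Real.exp (-(β * (χ 1 - χ g).re))

/-- The Wilson action `S_Λ(σ) = Σ_{p ∈ Λ₂} Re (χ(1) - χ(σ_p))`. -/
def action (Λ : Box) (χ : G → ℂ) (σ : EdgeConf Λ G) : ℝ :=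
  ∑ᶠ p : Plaq Λ, (χ 1 - χ (holP σ p)).re

/-- The partition function `Z_{Λ,β}` of the lattice gauge theory. -/
def muZ (Λ : Box) (G : Type*) [Group G] (χ : G → ℂ) (β : ℝ) : ℝ :=
  ∑ᶠ σ : EdgeConf Λ G, Real.exp (-(β * action Λ χ σ))

/-- The probability `μ_{Λ,β}(σ) = Z⁻¹ e^{-β S_Λ(σ)}` of an edge configuration. -/
def muP (Λ : Box) (χ : G → ℂ) (β : ℝ) (σ : EdgeConf Λ G) : ℝ :=
  Real.exp (-(β * action Λ χ σ)) / muZ Λ G χ β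

/-- Expectation `E[f(Σ)]` for `Σ ∼ μ_{Λ,β}`. -/
def muE (Λ : Box) (χ : G → ℂ) (β : ℝ) (f : EdgeConf Λ G → ℂ) : ℂ :=
  ∑ᶠ σ : EdgeConf Λ G, (muP Λ χ β σ : ℂ) * f σ

/-- Covariance `Cov(f(Σ), g(Σ))` for `Σ ∼ μ_{Λ,β}`. -/
def muCov (Λ : Box) (χ : G → ℂ) (β : ℝ) (f g : EdgeConf Λ G → ℂ) : ℂ :=
  muE Λ χ β (fun σ => f σ * g σ) - muE Λ χ β f * muE Λ χ β g

section HomSide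

variable (Λ : Box) (x₀ : VSite Λ)

/-- Given fixed paths `ℓ(x₀,x)` and a closed loop `γ` based at `u`, the loop
`ξ_γ = ℓ(x₀,u) γ ℓ(x₀,u)⁻¹ ∈ π₁(S₁(Λ), x₀)` (as a based closed walk). -/
def xiLoop (ℓb : ∀ x : VSite Λ, (latticeGraph Λ).Walk x₀ x) {u : VSite Λ}
    (γ : (latticeGraph Λ).Walk u u) : (latticeGraph Λ).Walk x₀ x₀ :=
  (ℓb u).append (γ.append (ℓb u).reverse)

variable {Λ x₀}

/-- `ψ(ξ_γ)` for a homomorphism `ψ ∈ Ω` and a closed loop `γ`. -/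
def evalLoop (ψ : Hom Λ x₀ G) (ℓb : ∀ x : VSite Λ, (latticeGraph Λ).Walk x₀ x)
    {u : VSite Λ} (γ : (latticeGraph Λ).Walk u u) : G :=
  ψ.toFun (xiLoop Λ x₀ ℓb γ)

/-- `ψ(ξ_p)` for a plaquette `p`. -/
def evalP (ψ : Hom Λ x₀ G) (ℓb : ∀ x : VSite Λ, (latticeGraph Λ).Walk x₀ x)
    (p : Plaq Λ) : G :=
  evalLoop ψ ℓb (plaqWalk p)

/-- The support `supp(ψ) = {p ∈ Λ₂ : ψ(ξ_p) ≠ 1}` of a homomorphism. -/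
def hsupp (ψ : Hom Λ x₀ G) (ℓb : ∀ x : VSite Λ, (latticeGraph Λ).Walk x₀ x) :
    Set (Plaq Λ) :=
  {p | evalP ψ ℓb p ≠ 1}

variable (Λ x₀)

/-- The (unnormalized) weight `∏_{p ∈ Λ₂} φ_β(ψ(ξ_p))` of a homomorphism. -/
def nuW (χ : G → ℂ) (β : ℝ) (ℓb : ∀ x : VSite Λ, (latticeGraph Λ).Walk x₀ x)
    (ψ : Hom Λ x₀ G) : ℝ :=
  ∏ᶠ p : Plaq Λ, phiB χ β (evalP ψ ℓb p)

/-- The normalizing constant `Z^ν_{Λ,β}`. -/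
def nuZ (G : Type*) [Group G] (χ : G → ℂ) (β : ℝ)
    (ℓb : ∀ x : VSite Λ, (latticeGraph Λ).Walk x₀ x) : ℝ :=
  ∑ᶠ ψ : Hom Λ x₀ G, nuW Λ x₀ χ β ℓb ψ

/-- The probability `ν_{Λ,β}(ψ)` of a homomorphism. -/
def nuP (χ : G → ℂ) (β : ℝ) (ℓb : ∀ x : VSite Λ, (latticeGraph Λ).Walk x₀ x)
    (ψ : Hom Λ x₀ G) : ℝ :=
  nuW Λ x₀ χ β ℓb ψ / nuZ Λ x₀ G χ β ℓb

/-- Expectation `E[h(Ψ)]` for `Ψ ∼ ν_{Λ,β}`. -/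
def nuE (χ : G → ℂ) (β : ℝ) (ℓb : ∀ x : VSite Λ, (latticeGraph Λ).Walk x₀ x)
    (h : Hom Λ x₀ G → ℂ) : ℂ :=
  ∑ᶠ ψ : Hom Λ x₀ G, (nuP Λ x₀ χ β ℓb ψ : ℂ) * h ψ

/-- Covariance `Cov(h₁(Ψ), h₂(Ψ))` for `Ψ ∼ ν_{Λ,β}`. -/
def nuCov (χ : G → ℂ) (β : ℝ) (ℓb : ∀ x : VSite Λ, (latticeGraph Λ).Walk x₀ x)
    (h₁ h₂ : Hom Λ x₀ G → ℂ) : ℂ :=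
  nuE Λ x₀ χ β ℓb (fun ψ => h₁ ψ * h₂ ψ) - nuE Λ x₀ χ β ℓb h₁ * nuE Λ x₀ χ β ℓb h₂

/-- For `Ψ₁, Ψ₂` i.i.d. `∼ ν_{Λ,β}`, the probability `P((Ψ₁,Ψ₂) ∈ S)`. -/
def nuP2 (χ : G → ℂ) (β : ℝ) (ℓb : ∀ x : VSite Λ, (latticeGraph Λ).Walk x₀ x)
    (S : Set (Hom Λ x₀ G × Hom Λ x₀ G)) : ℝ :=
  ∑ᶠ pr ∈ S, nuP Λ x₀ χ β ℓb pr.1 * nuP Λ x₀ χ β ℓb pr.2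

end HomSide

/-- Conjugacy invariance: `f(h₁⁻¹g₁h₁, …, h_k⁻¹g_kh_k) = f(g₁, …, g_k)`. -/
def ConjInvariant {G : Type*} [Group G] {k : ℕ} (f : (Fin k → G) → ℂ) : Prop :=
  ∀ g h : Fin k → G, f (fun i => (h i)⁻¹ * g i * h i) = f g

/-- The sup norm `‖f‖_∞` of a complex-valued function. -/
def supNorm {α : Type*} (f : α → ℂ) : ℝ := ⨆ x, ‖f x‖


/-- A rectangle `B = [x₁,y₁] × ⋯ × [x₄,y₄]` contained in `Λ` (degenerate sides allowed). -/
structure Rect (Λ : Box) where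
  lo : Fin 4 → ℤ
  hi : Fin 4 → ℤ
  lo_le_hi : ∀ i, lo i ≤ hi i
  a_le_lo : ∀ i, Λ.a i ≤ lo i
  hi_le_b : ∀ i, hi i ≤ Λ.b i

namespace Rect

variable {Λ : Box}

/-- A site is a vertex of the rectangle. -/
def memV (B : Rect Λ) (x : Site) : Prop := ∀ i, B.lo i ≤ x i ∧ x i ≤ B.hi i

/-- A plaquette is contained in the rectangle (all four corners are vertices of it). -/
def plaqIn (B : Rect Λ) (p : Plaq Λ) : Prop :=
  B.memV (p.c0 : Site) ∧ B.memV (p.c1 : Site) ∧ B.memV (p.c2 : Site) ∧ B.memV (p.c3 : Site)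

/-- The set of plaquettes contained in the rectangle. -/
def plaqSet (B : Rect Λ) : Set (Plaq Λ) := {p | B.plaqIn p}

/-- `|B|`: the number of plaquettes contained in the rectangle. -/
def plaqCard (B : Rect Λ) : ℕ := Nat.card B.plaqSet

end Rect

/-- A walk is contained in a rectangle if all its vertices are vertices of the rectangle. -/
def WalkInRect {Λ : Box} (B : Rect Λ) {u v : VSite Λ}
    (w : (latticeGraph Λ).Walk u v) : Prop :=
  ∀ x ∈ w.support, B.memV (x : Site)

/-- The four boundary edges of a plaquette (as ordered pairs of vertices). -/
def plaqEdges {Λ : Box} (p : Plaq Λ) : List (VSite Λ × VSite Λ) :=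
  [(p.c0, p.c1), (p.c1, p.c2), (p.c3, p.c2), (p.c0, p.c3)]

/-- `(u,v)` is an (unoriented) edge of the 2-complex generated by the plaquette set `Q`. -/
def edgeInComplex {Λ : Box} (Q : Set (Plaq Λ)) (u v : VSite Λ) : Prop :=
  ∃ p ∈ Q, (u, v) ∈ plaqEdges p ∨ (v, u) ∈ plaqEdges p

/-- `u` is a vertex of the 2-complex generated by the plaquette set `Q`. -/
def vertexInComplex {Λ : Box} (Q : Set (Plaq Λ)) (u : VSite Λ) : Prop :=
  ∃ p ∈ Q, u = p.c0 ∨ u = p.c1 ∨ u = p.c2 ∨ u = p.c3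

/-- A walk lies in the 2-complex generated by `Q` if all its vertices and edges do. -/
def WalkInComplex {Λ : Box} (Q : Set (Plaq Λ)) {u v : VSite Λ}
    (w : (latticeGraph Λ).Walk u v) : Prop :=
  (∀ x ∈ w.support, vertexInComplex Q x) ∧
  (∀ d ∈ w.darts, edgeInComplex Q d.toProd.1 d.toProd.2)

/-- One step of combinatorial homotopy of walks within the 2-complex generated by `Q`:
inserting/removing a backtracking along an edge of the complex, or inserting/removing the
boundary loop of a plaquette of the complex. -/
inductive CHStep {Λ : Box} (Q : Set (Plaq Λ)) :
    {u v : VSite Λ} → (latticeGraph Λ).Walk u v → (latticeGraph Λ).Walk u v → Prop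
  | back {u x y v : VSite Λ} (p : (latticeGraph Λ).Walk u x) (h : (latticeGraph Λ).Adj x y)
      (he : edgeInComplex Q x y) (q : (latticeGraph Λ).Walk x v) :
      CHStep Q (p.append (SimpleGraph.Walk.cons h (SimpleGraph.Walk.cons h.symm q)))
        (p.append q)
  | plaq {u v : VSite Λ} (pl : Plaq Λ) (hpl : pl ∈ Q)
      (w₁ : (latticeGraph Λ).Walk u pl.c0) (w₂ : (latticeGraph Λ).Walk pl.c0 v) :
      CHStep Q (w₁.append ((plaqWalk pl).append w₂)) (w₁.append w₂)

/-- Homotopy of walks within the 2-complex generated by `Q`. -/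
def CHomotopic {Λ : Box} (Q : Set (Plaq Λ)) {u v : VSite Λ}
    (w₁ w₂ : (latticeGraph Λ).Walk u v) : Prop :=
  Relation.EqvGen (@CHStep Λ Q u v) w₁ w₂

/-- A 2-complex (given by a plaquette set `Q`, together with all its edges and vertices)
is simply connected: it is path connected and every closed walk in it is null-homotopic
within it. -/
def SimplyConnectedC {Λ : Box} (Q : Set (Plaq Λ)) : Prop :=
  (∀ u v : VSite Λ, vertexInComplex Q u → vertexInComplex Q v →
     ∃ w : (latticeGraph Λ).Walk u v, WalkInComplex Q w) ∧
  (∀ u : VSite Λ, ∀ w : (latticeGraph Λ).Walk u u, WalkInComplex Q w →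
     CHomotopic Q w SimpleGraph.Walk.nil)

/-- The 2-complex `S₂(B)`: all plaquettes of the rectangle `B`. -/
def S2 {Λ : Box} (B : Rect Λ) : Set (Plaq Λ) := B.plaqSet

/-- A plaquette lies on the (topological) boundary of a rectangle. -/
def Plaq.onRectBoundary {Λ : Box} (B : Rect Λ) (p : Plaq Λ) : Prop :=
  B.plaqIn p ∧ ∃ k : Fin 4, k ≠ p.1.2.1 ∧ k ≠ p.1.2.2 ∧
    (p.1.1 k = B.lo k ∨ p.1.1 k = B.hi k)

/-- A plaquette lies on the boundary of the lattice `Λ`. -/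
def Plaq.onBoxBoundary {Λ : Box} (p : Plaq Λ) : Prop :=
  ∃ k : Fin 4, k ≠ p.1.2.1 ∧ k ≠ p.1.2.2 ∧ (p.1.1 k = Λ.a k ∨ p.1.1 k = Λ.b k)

/-- The 2-complex `∂S₂(B)`: plaquettes on the boundary of `B` but not on the boundary of `Λ`. -/
def bS2 {Λ : Box} (B : Rect Λ) : Set (Plaq Λ) :=
  {p | p.onRectBoundary B ∧ ¬ p.onBoxBoundary}

/-- The 2-complex `S₂ᶜ(B)`: all plaquettes of `Λ` not contained in `B`, together with `∂S₂(B)`. -/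
def S2c {Λ : Box} (B : Rect Λ) : Set (Plaq Λ) :=
  {p | ¬ B.plaqIn p} ∪ bS2 B

/-- `P₁, P₂` are well separated by the rectangle `B`. -/
def WellSeparated {Λ : Box} (B : Rect Λ) (P₁ P₂ : Set (Plaq Λ)) : Prop :=
  P₁ ⊆ S2 B ∧ P₂ ⊆ S2c B ∧ ∀ p ∈ P₁ ∪ P₂, p ∉ bS2 B

/-- A good rectangle: `S₂(B)`, `S₂ᶜ(B)` and `∂S₂(B)` are all simply connected. -/
def GoodRect {Λ : Box} (B : Rect Λ) : Prop :=
  SimplyConnectedC (S2 B) ∧ SimplyConnectedC (S2c B) ∧ SimplyConnectedC (bS2 B)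

/-- `P₁` is well separated from `P₂` by some good rectangle. -/
def WellSepGood {Λ : Box} (P₁ P₂ : Set (Plaq Λ)) : Prop :=
  ∃ B : Rect Λ, GoodRect B ∧ WellSeparated B P₁ P₂

/-- Union of a list of sets. -/
def unionList {α : Type*} (Ks : List (Set α)) : Set α := {x | ∃ K ∈ Ks, x ∈ K}

/-- `Ks` is a knot decomposition of the plaquette set `P`: a maximal partition
`P = K₁ ∪ ⋯ ∪ K_m` such that each `K_i` is well separated from `K_{i+1} ∪ ⋯ ∪ K_m`
by a good rectangle. -/
structure IsKnotDecomp {Λ : Box} (P : Set (Plaq Λ)) (Ks : List (Set (Plaq Λ))) : Prop where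
  union_eq : unionList Ks = P
  nonempty : ∀ K ∈ Ks, K.Nonempty
  pairwise_disjoint : Ks.Pairwise Disjoint
  sep : ∀ (n : ℕ) (hn : n + 1 < Ks.length),
    WellSepGood (Ks.get ⟨n, Nat.lt_of_succ_lt hn⟩) (unionList (Ks.drop (n + 1)))
  maximal : ∀ K ∈ Ks, ¬ ∃ K₁ K₂ : Set (Plaq Λ), K₁.Nonempty ∧ K₂.Nonempty ∧
    Disjoint K₁ K₂ ∧ K₁ ∪ K₂ = K ∧ WellSepGood K₁ K₂

/-- The collection `𝒦` of knots: all sets appearing in the (fixed) knot decomposition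
`KD P` of some plaquette set `P`. -/
def Knots {Λ : Box} (KD : Set (Plaq Λ) → List (Set (Plaq Λ))) : Set (Set (Plaq Λ)) :=
  {K | ∃ P : Set (Plaq Λ), K ∈ KD P}

/-- `GF(T)`: edge configurations equal to `1` on every edge of the graph `T`. -/
def GF {Λ : Box} (G : Type*) [Group G] (T : SimpleGraph (VSite Λ)) :
    Set (EdgeConf Λ G) :=
  {σ | ∀ e : PEdge Λ, T.Adj e.v0 e.v1 → σ e = 1}

/-- The 1-skeleton of the 2-complex generated by the plaquette set `Q`, as a graph. -/
def skel {Λ : Box} (Q : Set (Plaq Λ)) : SimpleGraph (VSite Λ) :=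
  SimpleGraph.fromRel (edgeInComplex Q)

/-- `T` is a spanning tree of the 1-skeleton `S₁(Λ)`. -/
def IsSpanningTree {Λ : Box} (T : SimpleGraph (VSite Λ)) : Prop :=
  T ≤ latticeGraph Λ ∧ T.IsTree

/-- `T` contains a spanning tree of the 2-complex generated by `Q`: any two vertices of the
complex are joined by a path using only edges lying both in `T` and in the complex. -/
def ContainsSpanningTreeOf {Λ : Box} (T : SimpleGraph (VSite Λ)) (Q : Set (Plaq Λ)) : Prop :=
  ∀ u v : VSite Λ, vertexInComplex Q u → vertexInComplex Q v → (T ⊓ skel Q).Reachable u v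

section Phi

variable (Λ : Box) (x₀ : VSite Λ) {G : Type*} [Group G]

/-- `supp_{P₀}(ψ₁, ψ₂) = supp(ψ₁) ∪ supp(ψ₂) ∪ P₀`. -/
def supp2 (ℓb : ∀ x : VSite Λ, (latticeGraph Λ).Walk x₀ x) (P₀ : Set (Plaq Λ))
    (ψ₁ ψ₂ : Hom Λ x₀ G) : Set (Plaq Λ) :=
  hsupp ψ₁ ℓb ∪ hsupp ψ₂ ℓb ∪ P₀

/-- The polymer counting function
`Φ²_{P₀}(P) = Σ_{ψ₁,ψ₂ : supp_{P₀}(ψ₁,ψ₂) = P} ∏_{p∈Λ₂} φ_β(ψ₁(ξ_p)) φ_β(ψ₂(ξ_p))`. -/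
def Phi2 (χ : G → ℂ) (β : ℝ) (ℓb : ∀ x : VSite Λ, (latticeGraph Λ).Walk x₀ x)
    (P₀ P : Set (Plaq Λ)) : ℝ :=
  ∑ᶠ pr : Hom Λ x₀ G × Hom Λ x₀ G,
    if supp2 Λ x₀ ℓb P₀ pr.1 pr.2 = P then
      ∏ᶠ p : Plaq Λ, phiB χ β (evalP pr.1 ℓb p) * phiB χ β (evalP pr.2 ℓb p)
    else 0

end Phi


section Swap

variable (Λ : Box) (x₀ : VSite Λ) (G : Type*) [Group G]

/-- Tuples of homomorphisms subordinate to the members of a list of plaquette sets. -/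
def TupleSpace (ℓb : ∀ x : VSite Λ, (latticeGraph Λ).Walk x₀ x)
    (Ks : List (Set (Plaq Λ))) : Type _ :=
  {t : Fin Ks.length → Hom Λ x₀ G // ∀ i, hsupp (t i) ℓb ⊆ Ks.get i}

/-- `P := supp(ψ₁) ∪ supp(ψ₂) ∪ B₁ ∪ B₂` for a pair of homomorphisms. -/
def bigP (ℓb : ∀ x : VSite Λ, (latticeGraph Λ).Walk x₀ x) (B₁ B₂ : Rect Λ)
    (pr : Hom Λ x₀ G × Hom Λ x₀ G) : Set (Plaq Λ) :=
  hsupp pr.1 ℓb ∪ hsupp pr.2 ℓb ∪ S2 B₁ ∪ S2 B₂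

/-- `B₁` and `B₂` lie in different knots of the knot decomposition of
`supp(ψ₁) ∪ supp(ψ₂) ∪ B₁ ∪ B₂`. -/
def inDiffKnots (KD : Set (Plaq Λ) → List (Set (Plaq Λ)))
    (ℓb : ∀ x : VSite Λ, (latticeGraph Λ).Walk x₀ x) (B₁ B₂ : Rect Λ)
    (pr : Hom Λ x₀ G × Hom Λ x₀ G) : Prop :=
  ∃ j₁ j₂ : Fin (KD (bigP Λ x₀ G ℓb B₁ B₂ pr)).length, j₁ ≠ j₂ ∧
    S2 B₁ ⊆ (KD (bigP Λ x₀ G ℓb B₁ B₂ pr)).get j₁ ∧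
    S2 B₂ ⊆ (KD (bigP Λ x₀ G ℓb B₁ B₂ pr)).get j₂

/-- The event `E(B₁,B₂) ⊆ Ω²`. -/
def Eset (KD : Set (Plaq Λ) → List (Set (Plaq Λ)))
    (ℓb : ∀ x : VSite Λ, (latticeGraph Λ).Walk x₀ x) (B₁ B₂ : Rect Λ) :
    Set (Hom Λ x₀ G × Hom Λ x₀ G) :=
  {pr | inDiffKnots Λ x₀ G KD ℓb B₁ B₂ pr}

/-- The swapping map `T : E(B₁,B₂) → E(B₁,B₂)` (extended by the identity off `E(B₁,B₂)`):
identify `ψ₁, ψ₂` with tuples via `Θ(P)`, exchange the coordinates of the knot containing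
`B₂`, and come back via `Θ(P)⁻¹`. -/
def swapT (KD : Set (Plaq Λ) → List (Set (Plaq Λ)))
    (ℓb : ∀ x : VSite Λ, (latticeGraph Λ).Walk x₀ x)
    (Θ : ∀ P : Set (Plaq Λ),
      {ψ : Hom Λ x₀ G // hsupp ψ ℓb ⊆ P} ≃ TupleSpace Λ x₀ G ℓb (KD P))
    (B₁ B₂ : Rect Λ) (pr : Hom Λ x₀ G × Hom Λ x₀ G) : Hom Λ x₀ G × Hom Λ x₀ G :=
  if h : inDiffKnots Λ x₀ G KD ℓb B₁ B₂ pr then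
    let P := bigP Λ x₀ G ℓb B₁ B₂ pr
    let j₂ : Fin (KD P).length := h.choose_spec.choose
    let t₁ := Θ P ⟨pr.1, fun p hp =>
      Set.mem_union_left _ (Set.mem_union_left _ (Set.mem_union_left _ hp))⟩
    let t₂ := Θ P ⟨pr.2, fun p hp =>
      Set.mem_union_left _ (Set.mem_union_left _ (Set.mem_union_right _ hp))⟩
    (((Θ P).symm ⟨Function.update t₁.1 j₂ (t₂.1 j₂), by
        intro i
        rcases eq_or_ne i j₂ with hi | hi
        · subst hi; rw [Function.update_self]; exact t₂.2 j₂
        · rw [Function.update_of_ne hi]; exact t₁.2 i⟩).1,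
     ((Θ P).symm ⟨Function.update t₂.1 j₂ (t₁.1 j₂), by
        intro i
        rcases eq_or_ne i j₂ with hi | hi
        · subst hi; rw [Function.update_self]; exact t₁.2 j₂
        · rw [Function.update_of_ne hi]; exact t₂.2 i⟩).1)
  else pr

end Swap


namespace Hom

variable {Λ : Box} {x₀ : VSite Λ}

/-- The value of `ψ` on the loop `a w b⁻¹`, where `a` and `b` are walks from the base point
to the endpoints of the walk `w`. -/
def val (ψ : Hom Λ x₀ G) {u v : VSite Λ} (a : (latticeGraph Λ).Walk x₀ u)
    (b : (latticeGraph Λ).Walk x₀ v) (w : (latticeGraph Λ).Walk u v) : G :=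
  ψ.toFun (a.append (w.append b.reverse))

lemma toFun_append_cancel (ψ : Hom Λ x₀ G) {u v : VSite Λ} (q : (latticeGraph Λ).Walk u v)
    (a : (latticeGraph Λ).Walk x₀ u) (b : (latticeGraph Λ).Walk u x₀) :
    ψ.toFun (a.append (q.append (q.reverse.append b))) = ψ.toFun (a.append b) := by
  induction q with
  | nil => simp
  | cons h q ih =>
    have key := ih (a.concat h) (Walk.cons h.symm b)
    rw [Walk.concat_append, Walk.concat_append] at key
    rw [← ψ.invariant _ _ (Relation.EqvGen.rel _ _ (HStep.mk a h b)), ← key]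
    simp only [Walk.reverse_cons, Walk.cons_append, Walk.nil_append, ← Walk.append_assoc]

lemma toFun_nil (ψ : Hom Λ x₀ G) : ψ.toFun Walk.nil = 1 := by
  simpa using ψ.map_mul Walk.nil Walk.nil

lemma val_append (ψ : Hom Λ x₀ G) {u v z : VSite Λ} (a : (latticeGraph Λ).Walk x₀ u)
    (b : (latticeGraph Λ).Walk x₀ v) (c : (latticeGraph Λ).Walk x₀ z)
    (w : (latticeGraph Λ).Walk u v) (w' : (latticeGraph Λ).Walk v z) :
    ψ.val a c (w.append w') = ψ.val a b w * ψ.val b c w' := by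
  have key := ψ.toFun_append_cancel b.reverse (a.append w) (w'.append c.reverse)
  rw [Walk.reverse_reverse] at key
  unfold val
  rw [← ψ.map_mul]
  simp only [← Walk.append_assoc] at key ⊢
  exact key.symm

lemma val_nil_self (ψ : Hom Λ x₀ G) {u : VSite Λ} (a : (latticeGraph Λ).Walk x₀ u) :
    ψ.val a a Walk.nil = 1 := by
  have key := ψ.toFun_append_cancel a Walk.nil Walk.nil
  simpa [val, toFun_nil] using key

lemma val_cons (ψ : Hom Λ x₀ G) {u v z : VSite Λ} (a : (latticeGraph Λ).Walk x₀ u)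
    (b : (latticeGraph Λ).Walk x₀ v) (c : (latticeGraph Λ).Walk x₀ z)
    (h : (latticeGraph Λ).Adj u v) (w : (latticeGraph Λ).Walk v z) :
    ψ.val a c (Walk.cons h w) = ψ.val a b h.toWalk * ψ.val b c w :=
  ψ.val_append a b c h.toWalk w

lemma val_symm (ψ : Hom Λ x₀ G) {u v : VSite Λ} (a : (latticeGraph Λ).Walk x₀ u)
    (b : (latticeGraph Λ).Walk x₀ v) (h : (latticeGraph Λ).Adj u v) :
    ψ.val b a h.symm.toWalk = (ψ.val a b h.toWalk)⁻¹ := by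
  refine eq_inv_of_mul_eq_one_right ?_
  rw [← val_append, ← ψ.val_nil_self a]
  have key := ψ.toFun_append_cancel h.toWalk a a.reverse
  simpa [val] using key

lemma val_concat (ψ : Hom Λ x₀ G) {u v : VSite Λ} (a : (latticeGraph Λ).Walk x₀ u)
    (h : (latticeGraph Λ).Adj u v) : ψ.val a (a.concat h) h.toWalk = 1 := by
  rw [← ψ.val_nil_self (a.concat h)]
  simp [val, Walk.concat_eq_append, ← Walk.append_assoc]

lemma val_eq_one_iff (ψ : Hom Λ x₀ G) {u : VSite Λ} (a b : (latticeGraph Λ).Walk x₀ u)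
    (w : (latticeGraph Λ).Walk u u) : ψ.val a a w = 1 ↔ ψ.val b b w = 1 := by
  have h₁ : ψ.val a a w = ψ.val a b Walk.nil * ψ.val b b w * ψ.val b a Walk.nil := by
    rw [← val_append, ← val_append]; simp
  have h₂ : ψ.val a b Walk.nil * ψ.val b a Walk.nil = 1 := by
    rw [← val_append]; exact ψ.val_nil_self a
  rw [h₁, eq_inv_of_mul_eq_one_right h₂, conj_eq_one_iff]

/-- A homomorphism is determined by its values on edges relative to a choice of walks
from the base point. -/
lemma ext_of_val_edge {ψ φ : Hom Λ x₀ G} (m : ∀ x : VSite Λ, (latticeGraph Λ).Walk x₀ x)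
    (h : ∀ (u v : VSite Λ) (e : (latticeGraph Λ).Adj u v),
      ψ.val (m u) (m v) e.toWalk = φ.val (m u) (m v) e.toWalk) : ψ = φ := by
  have hw : ∀ {u v : VSite Λ} (w : (latticeGraph Λ).Walk u v),
      ψ.val (m u) (m v) w = φ.val (m u) (m v) w := by
    intro u v w
    induction w with
    | nil => rw [val_nil_self, val_nil_self]
    | @cons _ v _ e w ih => rw [ψ.val_cons _ (m v), φ.val_cons _ (m v), ih, h]
  have hconj : ∀ (χ : Hom Λ x₀ G) (w : (latticeGraph Λ).Walk x₀ x₀),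
      χ.toFun w =
        (χ.val (m x₀) (m x₀) (m x₀))⁻¹ * χ.val (m x₀) (m x₀) w * χ.val (m x₀) (m x₀) (m x₀) := by
    intro χ w
    have hinv : χ.toFun (m x₀) * χ.toFun (m x₀).reverse = 1 := by
      simpa [val, χ.map_mul] using χ.val_nil_self (m x₀)
    simp only [val, χ.map_mul, eq_inv_of_mul_eq_one_right hinv]
    group
  have hfun : ψ.toFun = φ.toFun := by
    funext w
    rw [hconj ψ, hconj φ, hw, hw]
  cases ψ
  cases φ
  congr

end Hom

/-- `u` is the parent of `v` in the comb-shaped spanning tree of `Λ` rooted at the corner `a`. -/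
def CombParent {Λ : Box} (u v : VSite Λ) : Prop :=
  ∃ i : Fin 4, (v : Site) = (u : Site) + unit i ∧ ∀ j, i < j → (u : Site) j = Λ.a j

section Comb

variable {Λ : Box}

lemma CombParent.adj {u v : VSite Λ} (h : CombParent u v) : (latticeGraph Λ).Adj u v :=
  let ⟨i, hi, _⟩ := h
  ⟨i, Or.inl hi⟩

lemma unit_apply_of_ne {i j : Fin 4} (h : j ≠ i) : unit i j = 0 := if_neg h

lemma CombParent.unique {u u' v : VSite Λ} (h : CombParent u v) (h' : CombParent u' v) :
    u = u' := by
  obtain ⟨i, hi, hij⟩ := h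
  obtain ⟨k, hk, hkj⟩ := h'
  have not_lt : ∀ {w w' : VSite Λ} {p q : Fin 4}, (w : Site) + unit p = (w' : Site) + unit q →
      (∀ j, p < j → (w : Site) j = Λ.a j) → ¬ p < q := by
    intro w w' p q he hw hpq
    have h₁ := congrFun he q
    rw [Pi.add_apply, Pi.add_apply, unit_apply_self, unit_apply_of_ne hpq.ne', hw q hpq] at h₁
    have h₂ := (w'.2 q).1
    omega
  have he := hi.symm.trans hk
  obtain rfl : i = k :=
    le_antisymm (le_of_not_gt (not_lt he.symm hkj)) (le_of_not_gt (not_lt he hij))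
  exact Subtype.ext (add_right_cancel he)

lemma wellFounded_combParent : WellFounded (CombParent (Λ := Λ)) := by
  refine Subrelation.wf (r := InvImage (· < ·)
    fun x : VSite Λ => (∑ j, ((x : Site) j - Λ.a j)).toNat) ?_ (InvImage.wf _ wellFounded_lt)
  rintro u v ⟨i, hi, -⟩
  have hu : 0 ≤ ∑ j, ((u : Site) j - Λ.a j) :=
    Finset.sum_nonneg fun j _ => sub_nonneg.2 (u.2 j).1
  have hv : ∑ j, ((v : Site) j - Λ.a j) = ∑ j, ((u : Site) j - Λ.a j) + 1 := by
    have : ∑ j, unit i j = 1 := by simp [unit]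
    rw [← this, ← Finset.sum_add_distrib]
    refine Finset.sum_congr rfl fun j _ => ?_
    rw [hi, Pi.add_apply]
    ring
  simp only [InvImage]
  omega

/-- Walks from the base point can be chosen compatibly with the comb-shaped spanning tree. -/
lemma exists_combWalks {x₀ : VSite Λ} (l : ∀ x : VSite Λ, (latticeGraph Λ).Walk x₀ x) :
    ∃ m : ∀ x : VSite Λ, (latticeGraph Λ).Walk x₀ x,
      ∀ (u v : VSite Λ) (h : CombParent u v), m v = (m u).concat h.adj := by
  let F : ∀ v : VSite Λ, (∀ u, CombParent u v → (latticeGraph Λ).Walk x₀ u) →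
      (latticeGraph Λ).Walk x₀ v := fun v rec =>
    if h : ∃ u, CombParent u v then (rec h.choose h.choose_spec).concat h.choose_spec.adj
    else l v
  refine ⟨wellFounded_combParent.fix F, fun u v h => ?_⟩
  rw [wellFounded_combParent.fix_eq]
  have hex : ∃ u, CombParent u v := ⟨u, h⟩
  have key : ∀ u' (h' : CombParent u' v), (wellFounded_combParent.fix F u').concat h'.adj =
      (wellFounded_combParent.fix F u).concat h.adj := by
    intro u' h'
    obtain rfl := h.unique h'
    rfl
  exact (dif_pos hex).trans (key _ hex.choose_spec)

/-- Every positively oriented edge outside the comb is the upper side of a plaquette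
whose two lateral sides belong to the comb. -/
lemma exists_plaq_of_not_combParent {u v : VSite Λ} {i : Fin 4}
    (hi : (v : Site) = (u : Site) + unit i) (h : ¬ CombParent u v) :
    ∃ p : Plaq Λ, p.c3 = u ∧ p.c2 = v ∧ CombParent p.c0 p.c3 ∧ CombParent p.c1 p.c2 := by
  have hne : ∃ j, i < j ∧ (u : Site) j ≠ Λ.a j := by
    by_contra! hcon
    exact h ⟨i, hi, hcon⟩
  obtain ⟨j, ⟨hij, hj⟩, hmax⟩ :=
    (Set.toFinite {j | i < j ∧ (u : Site) j ≠ Λ.a j}).exists_maximal hne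
  have hzero : ∀ k, j < k → (u : Site) k = Λ.a k := fun k hk => by
    by_contra hka
    exact (hmax ⟨hij.trans hk, hka⟩ hk.le).not_gt hk
  have hlt : Λ.a j < (u : Site) j := lt_of_le_of_ne (u.2 j).1 (Ne.symm hj)
  have hsub : ∀ k, Λ.a k ≤ (u : Site) k - unit j k := fun k => by
    by_cases hk : k = j
    · subst hk
      rw [unit_apply_self]
      omega
    · rw [unit_apply_of_ne hk, sub_zero]
      exact (u.2 k).1
  have h₂ : (u : Site) - unit j + unit i + unit j = v := by rw [hi]; abel
  have h₃ : (u : Site) - unit j + unit j = u := sub_add_cancel _ _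
  have m₀ : Λ.mem ((u : Site) - unit j) := fun k =>
    ⟨hsub k, (sub_le_self _ (unit_apply_nonneg j k)).trans (u.2 k).2⟩
  have m₁ : Λ.mem ((u : Site) - unit j + unit i) := fun k =>
    ⟨(m₀ k).1.trans (le_add_of_nonneg_right (unit_apply_nonneg i k)),
      (le_add_of_nonneg_right (unit_apply_nonneg j k)).trans
        ((congrFun h₂ k).le.trans (v.2 k).2)⟩
  refine ⟨⟨((u : Site) - unit j, i, j), hij, m₀, m₁, h₂ ▸ v.2, h₃.symm ▸ u.2⟩,
    Subtype.ext h₃, Subtype.ext h₂, ⟨j, rfl, fun k hk => ?_⟩, ⟨j, rfl, fun k hk => ?_⟩⟩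
  · simp [Plaq.c0, unit_apply_of_ne hk.ne', hzero k hk]
  · simp [Plaq.c1, unit_apply_of_ne hk.ne', unit_apply_of_ne (hij.trans hk).ne', hzero k hk]

/-- With walks chosen along the comb, a homomorphism is determined by its values on
plaquettes. -/
lemma Hom.ext_of_evalP {x₀ : VSite Λ} {m : ∀ x : VSite Λ, (latticeGraph Λ).Walk x₀ x}
    (hm : ∀ (u v : VSite Λ) (h : CombParent u v), m v = (m u).concat h.adj)
    {ψ φ : Hom Λ x₀ G} (h : ∀ p : Plaq Λ, evalP ψ m p = evalP φ m p) : ψ = φ := by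
  have hcomb : ∀ (χ : Hom Λ x₀ G) {u v : VSite Λ}, CombParent u v →
      ∀ e : (latticeGraph Λ).Adj u v, χ.val (m u) (m v) e.toWalk = 1 := by
    intro χ u v huv e
    rw [hm u v huv]
    exact χ.val_concat (m u) e
  have hplaq : ∀ (χ : Hom Λ x₀ G) (p : Plaq Λ), CombParent p.c0 p.c3 → CombParent p.c1 p.c2 →
      evalP χ m p = χ.val (m p.c0) (m p.c1) p.adj01.toWalk *
        (χ.val (m p.c3) (m p.c2) p.adj23.symm.toWalk)⁻¹ := by
    intro χ p h03 h12
    change χ.val (m p.c0) (m p.c0) (plaqWalk p) = _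
    rw [plaqWalk, χ.val_cons _ (m p.c1), χ.val_cons _ (m p.c2), χ.val_cons _ (m p.c3),
      χ.val_cons _ (m p.c0), val_nil_self, hcomb χ h12,
      χ.val_symm (m p.c0) (m p.c3) p.adj30.symm, hcomb χ h03,
      χ.val_symm (m p.c3) (m p.c2) p.adj23.symm]
    simp
  have hpos : ∀ u v : VSite Λ, (∃ i, (v : Site) = (u : Site) + unit i) →
      ∀ e : (latticeGraph Λ).Adj u v,
        ψ.val (m u) (m v) e.toWalk = φ.val (m u) (m v) e.toWalk := by
    intro u
    induction u using wellFounded_combParent.induction with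
    | _ u ih =>
      rintro v ⟨i, hi⟩ e
      by_cases huv : CombParent u v
      · rw [hcomb ψ huv, hcomb φ huv]
      · obtain ⟨p, rfl, rfl, h03, h12⟩ := exists_plaq_of_not_combParent hi huv
        have hp := h p
        rw [hplaq ψ p h03 h12, hplaq φ p h03 h12, ih _ h03 _ ⟨p.1.2.1, rfl⟩] at hp
        exact inv_injective (mul_left_cancel hp)
  refine Hom.ext_of_val_edge m fun u v e => ?_
  obtain ⟨i, hi | hi⟩ := id e
  · exact hpos u v ⟨i, hi⟩ e
  · rw [ψ.val_symm (m v) (m u) e.symm, φ.val_symm (m v) (m u) e.symm, hpos v u ⟨i, hi⟩]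

instance (Λ : Box) : Finite (Plaq Λ) := by
  refine Finite.of_injective
    (fun p : Plaq Λ => ((⟨p.1.1, fun i => (p.2.2.1 i).1, fun i => (p.2.2.1 i).2⟩ :
      Set.Icc Λ.a Λ.b), p.1.2)) fun p q h => ?_
  exact Subtype.ext (Prod.ext (congrArg (fun z => z.1.1) h) (congrArg (fun z => z.2) h))

end Comb

/-- For any plaquette set `P ⊆ Λ₂`, the number of homomorphisms `ψ ∈ Ω`
with `supp(ψ) = P` is at most `|G|^{|P|}`. -/
theorem card_hom_support_le
    (Λ : Box) (x₀ : VSite Λ) (G : Type*) [Group G] [Finite G]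
    (ℓb : ∀ x : VSite Λ, (latticeGraph Λ).Walk x₀ x)
    (P : Set (Plaq Λ)) :
    Nat.card {ψ : Hom Λ x₀ G // hsupp ψ ℓb = P} ≤ Nat.card G ^ Nat.card P := by
  obtain ⟨m, hm⟩ := exists_combWalks ℓb
  have hone : ∀ (ψ : Hom Λ x₀ G) (p : Plaq Λ), evalP ψ ℓb p = 1 ↔ evalP ψ m p = 1 :=
    fun ψ p => ψ.val_eq_one_iff (ℓb p.c0) (m p.c0) (plaqWalk p)
  rw [← Nat.card_fun]
  refine Nat.card_le_card_of_injective (fun ψ (p : P) => evalP ψ.1 m p) fun ψ φ h => ?_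
  have hout : ∀ χ : {ψ : Hom Λ x₀ G // hsupp ψ ℓb = P}, ∀ p ∉ P, evalP χ.1 m p = 1 := by
    intro χ p hp
    rw [← χ.2] at hp
    exact (hone χ.1 p).1 (not_not.1 hp)
  refine Subtype.ext (Hom.ext_of_evalP hm fun p => ?_)
  by_cases hp : p ∈ P
  · exact congrFun h ⟨p, hp⟩
  · rw [hout ψ p hp, hout φ p hp]

end LGT
end
end

section
/- Let Σ be a random edge configuration with law μ_{Λ,β}. Then the random homomorphism ψ_{x₀}(Σ) has law ν_{Λ,β}; that is, the pushforward of μ_{Λ,β} under ψ_{x₀} equals ν_{Λ,β}. -/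
open Classical SimpleGraph
open scoped BigOperators

noncomputable section

namespace LGT

variable {G : Type*} [Group G]

variable {G : Type*} [Group G]

/-! ### Holonomy and homomorphisms modulo backtracking -/

lemma homotopic_cancel {Λ : Box} {u x y v : VSite Λ} (p : (latticeGraph Λ).Walk u x)
    (q : (latticeGraph Λ).Walk y x) (r : (latticeGraph Λ).Walk x v) :
    Homotopic (p.append (q.reverse.append (q.append r))) (p.append r) := by
  induction q with
  | nil => exact Relation.EqvGen.refl _
  | cons h q ih =>
    refine Relation.EqvGen.trans _ _ _ (Relation.EqvGen.rel _ _ ?_) (ih p r)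
    have hs := HStep.mk (p.append q.reverse) h.symm (q.append r)
    simpa [← SimpleGraph.Walk.append_assoc] using hs

lemma hol_reverse {Λ : Box} {G : Type*} [Group G] (σ : EdgeConf Λ G) {u v : VSite Λ}
    (w : (latticeGraph Λ).Walk u v) : hol σ w.reverse = (hol σ w)⁻¹ := by
  have h := hol_homotopic σ (homotopic_cancel .nil w .nil)
  simp only [SimpleGraph.Walk.nil_append, hol_append, hol_nil, mul_one] at h
  exact eq_inv_of_mul_eq_one_left h

namespace Hom

variable {Λ : Box} {x₀ : VSite Λ} {G : Type*} [Group G]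

@[ext] lemma ext {ψ φ : Hom Λ x₀ G} (h : ∀ w, ψ.toFun w = φ.toFun w) : ψ = φ := by
  cases ψ
  cases φ
  congr
  exact funext h

lemma map_nil (ψ : Hom Λ x₀ G) : ψ.toFun .nil = 1 := by
  have h := ψ.map_mul .nil .nil
  rw [SimpleGraph.Walk.nil_append] at h
  exact left_eq_mul.mp h

lemma map_append_reverse (ψ : Hom Λ x₀ G) {x : VSite Λ} (q : (latticeGraph Λ).Walk x₀ x) :
    ψ.toFun (q.append q.reverse) = 1 := by
  have h := ψ.invariant _ _ (homotopic_cancel .nil q.reverse .nil)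
  simpa [map_nil] using h

/-- The edge configuration in the fibre of `psi` over `ψ` whose holonomy along the
reference path to each vertex `x` is `f x`. -/
def lift (ℓ : ∀ x : VSite Λ, (latticeGraph Λ).Walk x₀ x) (ψ : Hom Λ x₀ G) (f : VSite Λ → G) :
    EdgeConf Λ G := fun e =>
  (f e.v0)⁻¹ * ψ.toFun ((ℓ e.v0).append
    (.cons (show (latticeGraph Λ).Adj e.v0 e.v1 from ⟨e.1.2, Or.inl rfl⟩) (ℓ e.v1).reverse))
    * f e.v1

end Hom

lemma unit_injective : Function.Injective unit := fun i j h => by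
  have h1 := congrFun h i
  rw [unit_apply_self] at h1
  by_contra hne
  simp [unit, hne] at h1

lemma oval_v0_v1 {Λ : Box} {G : Type*} [Group G] (σ : EdgeConf Λ G) (e : PEdge Λ) :
    oval σ e.v0 e.v1 = σ e := by
  have h : ∃ i : Fin 4, (e.v1 : Site) = (e.v0 : Site) + unit i := ⟨e.1.2, rfl⟩
  rw [oval, dif_pos h]
  congr 1
  exact Subtype.ext (Prod.ext rfl (unit_injective (add_left_cancel h.choose_spec.symm)))

lemma exists_pedge_of_adj {Λ : Box} {u v : VSite Λ} (h : (latticeGraph Λ).Adj u v) :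
    ∃ e : PEdge Λ, (e.v0 = u ∧ e.v1 = v) ∨ (e.v0 = v ∧ e.v1 = u) := by
  obtain ⟨i, hi | hi⟩ := h
  · exact ⟨⟨(u, i), u.2, hi ▸ v.2⟩, Or.inl ⟨rfl, Subtype.ext hi.symm⟩⟩
  · exact ⟨⟨(v, i), v.2, hi ▸ u.2⟩, Or.inr ⟨rfl, Subtype.ext hi.symm⟩⟩

section Fibre

variable {Λ : Box} {x₀ : VSite Λ} {G : Type*} [Group G]
  (ℓ : ∀ x : VSite Λ, (latticeGraph Λ).Walk x₀ x) (ψ : Hom Λ x₀ G)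

lemma Hom.map_cons_mul {u m v : VSite Λ} (h : (latticeGraph Λ).Adj u m)
    (q : (latticeGraph Λ).Walk m v) :
    ψ.toFun ((ℓ u).append (.cons h (ℓ m).reverse)) *
        ψ.toFun ((ℓ m).append (q.append (ℓ v).reverse)) =
      ψ.toFun ((ℓ u).append ((SimpleGraph.Walk.cons h q).append (ℓ v).reverse)) := by
  rw [← ψ.map_mul]
  have hc := ψ.invariant _ _
    (homotopic_cancel ((ℓ u).append (.cons h .nil)) (ℓ m) (q.append (ℓ v).reverse))
  simpa [← SimpleGraph.Walk.append_assoc] using hc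

lemma Hom.oval_lift (f : VSite Λ → G) {u v : VSite Λ} (h : (latticeGraph Λ).Adj u v) :
    oval (ψ.lift ℓ f) u v =
      (f u)⁻¹ * ψ.toFun ((ℓ u).append (.cons h (ℓ v).reverse)) * f v := by
  obtain ⟨e, ⟨rfl, rfl⟩ | ⟨rfl, rfl⟩⟩ := exists_pedge_of_adj h
  · exact oval_v0_v1 _ e
  · have h1 : ψ.toFun ((ℓ e.v0).append (.cons h.symm (ℓ e.v1).reverse)) *
        ψ.toFun ((ℓ e.v1).append (.cons h (ℓ e.v0).reverse)) = 1 := by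
      have h2 := ψ.map_cons_mul ℓ h.symm (.cons h .nil)
      have h3 := ψ.invariant _ _ (Relation.EqvGen.rel _ _
        (HStep.mk (ℓ e.v0) h.symm (ℓ e.v0).reverse))
      rw [ψ.map_append_reverse] at h3
      exact h2.trans h3
    rw [eq_inv_of_mul_eq_one_left (oval_mul_oval (ψ.lift ℓ f) h), oval_v0_v1, Hom.lift,
      eq_inv_of_mul_eq_one_left h1]
    group

lemma Hom.hol_lift (f : VSite Λ → G) {u v : VSite Λ} (w : (latticeGraph Λ).Walk u v) :
    hol (ψ.lift ℓ f) w =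
      (f u)⁻¹ * ψ.toFun ((ℓ u).append (w.append (ℓ v).reverse)) * f v := by
  induction w with
  | nil => simp [ψ.map_append_reverse]
  | cons h q ih =>
    rw [hol_cons, ih, ψ.oval_lift ℓ f h, ← ψ.map_cons_mul]
    group

/-- The fibre of `psi` over any homomorphism is parametrized by the holonomies along
reference paths to the vertices. -/
def fibreEquiv (hℓ : ℓ x₀ = .nil) :
    {σ : EdgeConf Λ G // psi Λ x₀ σ = ψ} ≃ {f : VSite Λ → G // f x₀ = 1} where
  toFun σ := ⟨fun x => hol σ.1 (ℓ x), by simp [hℓ]⟩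
  invFun f := ⟨ψ.lift ℓ f.1, by
    ext w
    change hol (ψ.lift ℓ f.1) w = _
    rw [ψ.hol_lift, f.2, hℓ]
    simp⟩
  left_inv := by
    rintro ⟨σ, rfl⟩
    refine Subtype.ext (funext fun e => ?_)
    simp only [Hom.lift, psi, hol_append, hol_cons, hol_reverse, oval_v0_v1]
    group
  right_inv f := by
    refine Subtype.ext (funext fun x => ?_)
    change hol (ψ.lift ℓ f.1) (ℓ x) = _
    rw [ψ.hol_lift, f.2, hℓ, SimpleGraph.Walk.nil_append, ψ.map_append_reverse]
    simp

end Fibre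

/-! ### Finiteness -/

instance (Λ : Box) : Finite (VSite Λ) :=
  Set.Finite.subset (Set.finite_Icc Λ.a Λ.b) fun _ hx =>
    ⟨fun i => (hx i).1, fun i => (hx i).2⟩

instance (Λ : Box) : Finite (PEdge Λ) :=
  Finite.of_injective (fun e : PEdge Λ => (e.v0, e.1.2)) fun e e' h => by
    simp only [PEdge.v0, Prod.mk.injEq, Subtype.mk.injEq] at h
    exact Subtype.ext (Prod.ext h.1 h.2)

instance inst_s4 (Λ : Box) : Finite (Plaq Λ) :=
  Finite.of_injective (fun p : Plaq Λ => (p.c0, p.1.2)) fun p p' h => by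
    simp only [Plaq.c0, Prod.mk.injEq, Subtype.mk.injEq] at h
    exact Subtype.ext (Prod.ext h.1 h.2)

/-! ### Comparison of the weights -/

lemma chi_conj {G : Type*} [Group G] {d : ℕ} (ρ : G →* Matrix.unitaryGroup (Fin d) ℂ)
    (g h : G) : chi ρ (h * g * h⁻¹) = chi ρ g := by
  simp only [chi]
  rw [map_mul, Submonoid.coe_mul, Matrix.trace_mul_comm, ← Submonoid.coe_mul, ← map_mul]
  simp

lemma exp_action_eq_nuW (Λ : Box) (x₀ : VSite Λ) {G : Type*} [Group G] {d : ℕ}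
    (ρ : G →* Matrix.unitaryGroup (Fin d) ℂ) (β : ℝ)
    (ℓb : ∀ x : VSite Λ, (latticeGraph Λ).Walk x₀ x) (σ : EdgeConf Λ G) :
    Real.exp (-(β * action Λ (chi ρ) σ)) = nuW Λ x₀ (chi ρ) β ℓb (psi Λ x₀ σ) := by
  have := Fintype.ofFinite (Plaq Λ)
  rw [action, nuW, finsum_eq_sum_of_fintype, finprod_eq_prod_of_fintype, Finset.mul_sum,
    ← Finset.sum_neg_distrib, Real.exp_sum]
  refine Finset.prod_congr rfl fun p _ => ?_
  have h : evalP (psi Λ x₀ σ) ℓb p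
      = hol σ (ℓb p.c0) * holP σ p * (hol σ (ℓb p.c0))⁻¹ := by
    simp only [evalP, evalLoop, xiLoop, psi, hol_append, hol_reverse, holP, mul_assoc]
  rw [phiB, h, chi_conj]


/-- If `Σ ∼ μ_{Λ,β}`, then `ψ_{x₀}(Σ) ∼ ν_{Λ,β}`: the pushforward of
`μ_{Λ,β}` under `ψ_{x₀}` equals `ν_{Λ,β}`. -/
theorem pushforward_psi_eq_nu
    (Λ : Box) (x₀ : VSite Λ) (G : Type*) [Group G] [Finite G]
    {d : ℕ} (ρ : G →* Matrix.unitaryGroup (Fin d) ℂ)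
    (β : ℝ) (hβ : 0 ≤ β)
    (ℓb : ∀ x : VSite Λ, (latticeGraph Λ).Walk x₀ x)
    (ψ : Hom Λ x₀ G) :
    (∑ᶠ σ ∈ {σ : EdgeConf Λ G | psi Λ x₀ σ = ψ}, muP Λ (chi ρ) β σ)
      = nuP Λ x₀ (chi ρ) β ℓb ψ := by
  let ℓ := Function.update ℓb x₀ .nil
  have hℓ : ℓ x₀ = .nil := Function.update_self ..
  have hsurj : Function.Surjective (psi (G := G) Λ x₀) := fun φ =>
    ⟨_, ((fibreEquiv ℓ φ hℓ).symm ⟨1, rfl⟩).2⟩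
  have : Finite (Hom Λ x₀ G) := Finite.of_surjective _ hsurj
  have := Fintype.ofFinite (Hom Λ x₀ G)
  have := Fintype.ofFinite (EdgeConf Λ G)
  have hfib (φ : Hom Λ x₀ G) : ∑ σ : EdgeConf Λ G with psi Λ x₀ σ = φ,
      Real.exp (-(β * action Λ (chi ρ) σ)) =
        Nat.card {f : VSite Λ → G // f x₀ = 1} * nuW Λ x₀ (chi ρ) β ℓb φ := by
    rw [Finset.sum_congr rfl (g := fun _ => nuW Λ x₀ (chi ρ) β ℓb φ) fun σ hσ => by
      rw [exp_action_eq_nuW Λ x₀ ρ β ℓb, (Finset.mem_filter.mp hσ).2], Finset.sum_const,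
      nsmul_eq_mul, ← Nat.card_congr (fibreEquiv ℓ φ hℓ), Nat.card_eq_fintype_card,
      Fintype.card_subtype]
  have hZ : muZ Λ G (chi ρ) β =
      Nat.card {f : VSite Λ → G // f x₀ = 1} * nuZ Λ x₀ G (chi ρ) β ℓb := by
    rw [muZ, nuZ, finsum_eq_sum_of_fintype, finsum_eq_sum_of_fintype, Finset.mul_sum,
      ← Finset.sum_fiberwise Finset.univ (psi Λ x₀)]
    exact Finset.sum_congr rfl fun φ _ => hfib φ
  have : Nonempty {f : VSite Λ → G // f x₀ = 1} := ⟨1, rfl⟩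
  have hN : (Nat.card {f : VSite Λ → G // f x₀ = 1} : ℝ) ≠ 0 :=
    Nat.cast_ne_zero.mpr Nat.card_pos.ne'
  rw [finsum_mem_eq_finite_toFinset_sum _ (Set.toFinite _),
    Finset.sum_congr (s₂ := Finset.univ.filter fun σ => psi Λ x₀ σ = ψ) (by ext; simp)
      fun _ _ => rfl]
  simp only [muP, nuP]
  rw [← Finset.sum_div, hfib, hZ, mul_div_mul_left _ _ hN]

end LGT
end
end

section
/- Let E ⊆ Ω², let h₁, h₂ : Ω → ℂ be arbitrary functions, and let T : E → E be a swapping map with respect to (E, h₁, h₂, ν_{Λ,β}). Let Ψ₁, Ψ₂ be independent, each with law ν_{Λ,β}. Then |Cov(h₁(Ψ₁), h₂(Ψ₁))| ≤ 2 ‖h₁‖_∞ ‖h₂‖_∞ P((Ψ₁, Ψ₂) ∉ E), where Cov(h₁(Ψ₁), h₂(Ψ₁)) = E[h₁(Ψ₁)h₂(Ψ₁)] − E[h₁(Ψ₁)]E[h₂(Ψ₁)]. -/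
open Classical SimpleGraph
open scoped BigOperators

noncomputable section

namespace LGT

variable {G : Type*} [Group G]

variable {G : Type*} [Group G]

lemma norm_le_supNorm {α : Type*} [Finite α] (f : α → ℂ) (x : α) : ‖f x‖ ≤ supNorm f :=
  le_ciSup (Set.finite_range fun x => ‖f x‖).bddAbove x

/-- A measure-preserving bijection of `E` carrying `h₁ ⊗ h₂` to the diagonal product makes
the contribution of `E` to the covariance vanish. -/
lemma sum_swap_eq_zero {Ω : Type*} [Fintype Ω] (ν : Ω → ℝ)
    (E : Set (Ω × Ω)) (h₁ h₂ : Ω → ℂ) (T : Ω × Ω → Ω × Ω)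
    (hbij : Set.BijOn T E E)
    (hmeas : ∀ pr ∈ E, ν (T pr).1 * ν (T pr).2 = ν pr.1 * ν pr.2)
    (hswap : ∀ pr ∈ E, h₁ pr.1 * h₂ pr.2 = h₁ (T pr).1 * h₂ (T pr).1) :
    ∑ pr : Ω × Ω with pr ∈ E, ((ν pr.1 * ν pr.2 : ℝ) : ℂ) *
      (h₁ pr.1 * h₂ pr.1 - h₁ pr.1 * h₂ pr.2) = 0 := by
  simp only [mul_sub, Finset.sum_sub_distrib]
  rw [sub_eq_zero]
  symm
  refine Finset.sum_bij (fun pr _ => T pr) ?_ ?_ ?_ ?_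
  · intro pr hpr
    simpa using hbij.mapsTo (by simpa using hpr)
  · intro a ha b hb hab
    exact hbij.injOn (by simpa using ha) (by simpa using hb) hab
  · intro b hb
    obtain ⟨a, ha, hab⟩ := hbij.surjOn (show b ∈ E by simpa using hb)
    exact ⟨a, by simpa using ha, hab⟩
  · intro pr hpr
    have hE : pr ∈ E := by simpa using hpr
    rw [hmeas pr hE, hswap pr hE]

/-- The covariance as a sum over pairs of independent copies. -/
lemma cov_eq_sum_prod {Ω : Type*} [Fintype Ω] (ν : Ω → ℝ) (hν1 : ∑ x : Ω, ν x = 1)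
    (h₁ h₂ : Ω → ℂ) :
    (∑ x : Ω, (ν x : ℂ) * (h₁ x * h₂ x)) -
        (∑ x : Ω, (ν x : ℂ) * h₁ x) * (∑ x : Ω, (ν x : ℂ) * h₂ x) =
      ∑ pr : Ω × Ω, ((ν pr.1 * ν pr.2 : ℝ) : ℂ) *
        (h₁ pr.1 * h₂ pr.1 - h₁ pr.1 * h₂ pr.2) := by
  have hν : ∑ x : Ω, (ν x : ℂ) = 1 := by exact_mod_cast hν1
  rw [← mul_one (∑ x : Ω, (ν x : ℂ) * (h₁ x * h₂ x)), ← hν, Finset.sum_mul_sum,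
    Finset.sum_mul_sum, Fintype.sum_prod_type, ← Finset.sum_sub_distrib]
  refine Finset.sum_congr rfl fun x _ => ?_
  rw [← Finset.sum_sub_distrib]
  refine Finset.sum_congr rfl fun y _ => ?_
  push_cast
  ring

/-- Lemma 3.2: if `T` is a swapping map with respect to `(E, h₁, h₂, ν)`
on a finite set `Ω` with probability measure `ν`, and `Ψ₁, Ψ₂` are i.i.d. with law `ν`, then
`|Cov(h₁(Ψ₁), h₂(Ψ₁))| ≤ 2 ‖h₁‖_∞ ‖h₂‖_∞ P((Ψ₁,Ψ₂) ∉ E)`. -/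
theorem swapping_map_covariance_bound
    {Ω : Type*} [Fintype Ω]
    (ν : Ω → ℝ) (hν0 : ∀ x, 0 ≤ ν x) (hν1 : ∑ x : Ω, ν x = 1)
    (E : Set (Ω × Ω)) (h₁ h₂ : Ω → ℂ) (T : Ω × Ω → Ω × Ω)
    (hbij : Set.BijOn T E E)
    (hmeas : ∀ pr ∈ E, ν (T pr).1 * ν (T pr).2 = ν pr.1 * ν pr.2)
    (hswap : ∀ pr ∈ E, h₁ pr.1 * h₂ pr.2 = h₁ (T pr).1 * h₂ (T pr).1) :
    ‖(∑ x : Ω, (ν x : ℂ) * (h₁ x * h₂ x)) -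
        (∑ x : Ω, (ν x : ℂ) * h₁ x) * (∑ x : Ω, (ν x : ℂ) * h₂ x)‖
      ≤ 2 * supNorm h₁ * supNorm h₂ *
        ∑ pr : Ω × Ω, (if pr ∈ E then 0 else ν pr.1 * ν pr.2) := by
  rw [cov_eq_sum_prod ν hν1, ← Finset.sum_filter_add_sum_filter_not Finset.univ (· ∈ E),
    sum_swap_eq_zero ν E h₁ h₂ T hbij hmeas hswap, zero_add, Finset.sum_filter, Finset.mul_sum]
  refine norm_sum_le_of_le _ fun pr _ => ?_
  by_cases hE : pr ∈ E
  · simp [hE]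
  · have hp : 0 ≤ ν pr.1 * ν pr.2 := mul_nonneg (hν0 _) (hν0 _)
    have hbound (x y : Ω) : ‖h₁ x * h₂ y‖ ≤ supNorm h₁ * supNorm h₂ := by
      rw [norm_mul]
      exact mul_le_mul (norm_le_supNorm h₁ x) (norm_le_supNorm h₂ y) (norm_nonneg _)
        ((norm_nonneg _).trans (norm_le_supNorm h₁ x))
    have hdiff : ‖h₁ pr.1 * h₂ pr.1 - h₁ pr.1 * h₂ pr.2‖ ≤ 2 * supNorm h₁ * supNorm h₂ := by
      linarith [norm_sub_le (h₁ pr.1 * h₂ pr.1) (h₁ pr.1 * h₂ pr.2),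
        hbound pr.1 pr.1, hbound pr.1 pr.2]
    rw [if_pos hE, if_neg hE, norm_mul, Complex.norm_of_nonneg hp, mul_comm]
    exact mul_le_mul_of_nonneg_right hdiff hp

end LGT
end
end
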